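/- There is an absolute constant k ∈ ℕ such that the following holds. Let G = (S₀, S₁, E) be a finite weighted game with maximal absolute weight W, t ∈ ℚ (t ≥ 0) a threshold, G' the expanded infinite-state game, and fix M ∈ ℕ; set M' = 2^{k·(M + |S| + |E|·W + |S|·(⌈t⌉+1))}. For every configuration γ = (s,c) of G' with c ≤ M and every set Γ' ⊆ Γ^{≤t}, if P₀ has a strategy in G' ensuring from γ that some configuration of Γ' is eventually visited, then P₀ also has a strategy ensuring from γ that some configuration of Γ' is eventually visited and that every configuration (s'', c'') visited before that satisfies c'' ≤ M'. -/

import Mathlib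

namespace AvgEnergy

/-- An integer-weighted edge over a state space `α`. -/
abbrev WEdge (α : Type*) : Type _ := α × ℤ × α

/-- A finite turn-based weighted game `G = (S₀, S₁, E)`:
`S₀` and `S₁` are disjoint sets of states covering `S`, edges carry integer
weights bounded in absolute value by `W`, and every state has an outgoing edge. -/
structure Game (S : Type*) where
  S0 : Set S
  S1 : Set S
  E : Set (WEdge S)
  W : ℕ
  disj : Disjoint S0 S1
  cover : S0 ∪ S1 = Set.univ
  wbound : ∀ e ∈ E, -(W : ℤ) ≤ e.2.1 ∧ e.2.1 ≤ (W : ℤ)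
  total : ∀ s : S, ∃ w s', (s, w, s') ∈ E

variable {α : Type*}

/-- A play from `s`: an infinite sequence of consecutive edges of `E` starting at `s`. -/
def IsPlay (E : Set (WEdge α)) (s : α) (π : ℕ → WEdge α) : Prop :=
  (∀ i, π i ∈ E) ∧ (π 0).1 = s ∧ ∀ i, (π i).2.2 = (π (i + 1)).1

/-- Energy level of the length-`n` prefix of `π`. -/
def EL (π : ℕ → WEdge α) (n : ℕ) : ℤ :=
  ∑ i ∈ Finset.range n, (π i).2.1

/-- Mean-payoff of the length-`n` prefix of `π`. -/
def MP (π : ℕ → WEdge α) (n : ℕ) : ℚ := (EL π n : ℚ) / n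

/-- Average-energy of the length-`n` prefix of `π`. -/
def AE (π : ℕ → WEdge α) (n : ℕ) : ℚ :=
  (∑ i ∈ Finset.range n, (EL π (i + 1) : ℚ)) / n

/-- `limsup_{n → ∞} f n ≤ t` (ε-characterization, valid in `ℚ`). -/
def LimsupLE (f : ℕ → ℚ) (t : ℚ) : Prop :=
  ∀ ε : ℚ, 0 < ε → ∃ N, ∀ n ≥ N, f n ≤ t + ε

/-- The state reached after following the finite prefix `ρ` from `s`. -/
def EndSt (s : α) (ρ : List (WEdge α)) : α :=
  (ρ.getLast?.map (fun e => e.2.2)).getD s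

/-- `ρ` is a finite play prefix from `s` in the graph with edge set `E`. -/
def IsPrefixFrom (E : Set (WEdge α)) (s : α) (ρ : List (WEdge α)) : Prop :=
  (∀ e ∈ ρ, e ∈ E) ∧ List.Chain' (fun e f => e.2.2 = f.1) ρ ∧
    ∀ e, ρ.head? = some e → e.1 = s

/-- A strategy (of the player owning the states in `S0`) from `s`: it assigns to every
play prefix from `s` ending in a state of `S0` a valid outgoing edge. -/
def IsStrategy (E : Set (WEdge α)) (S0 : Set α) (s : α)
    (σ : List (WEdge α) → WEdge α) : Prop :=
  ∀ ρ, IsPrefixFrom E s ρ → EndSt s ρ ∈ S0 → σ ρ ∈ E ∧ (σ ρ).1 = EndSt s ρ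

/-- The length-`n` prefix of a play, as a list of edges. -/
def Pref (π : ℕ → WEdge α) (n : ℕ) : List (WEdge α) :=
  List.ofFn (fun i : Fin n => π i)

/-- `π` is an outcome of the strategy `σ` (for the player owning `S0`) from `s`. -/
def IsOutcome (E : Set (WEdge α)) (S0 : Set α) (s : α)
    (σ : List (WEdge α) → WEdge α) (π : ℕ → WEdge α) : Prop :=
  IsPlay E s π ∧ ∀ n, EndSt s (Pref π n) ∈ S0 → π n = σ (Pref π n)

/-- Configurations of the expanded game: `⊥` is `none`. -/
abbrev Conf (S : Type*) := Option (S × ℕ)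

/-- Edges of the expanded infinite-state weighted game `G'`:
`((s,c), c', (s',c'))` whenever `(s,w,s') ∈ E` and `c' = c + w ≥ 0`;
`((s,c), ⌈t⌉+1, ⊥)` whenever some `(s,w,s') ∈ E` has `c + w < 0`; and
`(⊥, ⌈t⌉+1, ⊥)`. -/
def ExpE {S : Type*} (G : Game S) (t : ℚ) : Set (WEdge (Conf S)) :=
  {e | (∃ (s : S) (c : ℕ) (w : ℤ) (s' : S) (c' : ℕ), (s, w, s') ∈ G.E ∧ (c : ℤ) + w = (c' : ℤ) ∧
          e = (some (s, c), (c' : ℤ), some (s', c'))) ∨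
       (∃ (s : S) (c : ℕ) (w : ℤ) (s' : S), (s, w, s') ∈ G.E ∧ (c : ℤ) + w < 0 ∧
          e = (some (s, c), ⌈t⌉ + 1, (none : Conf S))) ∨
       e = ((none : Conf S), ⌈t⌉ + 1, (none : Conf S))}

/-- The configurations of the expanded game belonging to player `P₀`. -/
def ExpS0 {S : Type*} (G : Game S) : Set (Conf S) :=
  {γ | ∃ s c, s ∈ G.S0 ∧ γ = some (s, c)}

/-- The state (configuration) visited at position `n` along a play from `s`:
`γ₀ = s` and `γ_{n+1}` is the target of the `(n+1)`-st edge. -/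
def StAt (s : α) (π : ℕ → WEdge α) : ℕ → α
  | 0 => s
  | n + 1 => (π n).2.2

end AvgEnergy

namespace AvgEnergy

section Sequences

/-- An increasing sequence of subsets of a finite type in which a stationary step is followed by
stationary steps only is constant from the cardinality of the type on. -/
theorem subset_of_stationary {D : Type*} [Finite D] (f : ℕ → Set D)
    (mono : ∀ b, f b ⊆ f (b + 1))
    (stat : ∀ b, f (b + 1) ⊆ f b → f (b + 2) ⊆ f (b + 1)) (b : ℕ) :
    f b ⊆ f (Nat.card D) := by
  have hm : Monotone f := monotone_nat_of_le_succ mono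
  obtain ⟨n, hn, hstat⟩ : ∃ n ≤ Nat.card D, f (n + 1) ⊆ f n := by
    by_contra! hc
    have hcard : ∀ n ≤ Nat.card D + 1, n ≤ (f n).ncard := by
      intro n
      induction n with
      | zero => simp
      | succ n ih =>
        intro hn
        have hlt : (f n).ncard < (f (n + 1)).ncard :=
          Set.ncard_lt_ncard ⟨mono n, hc n (by omega)⟩ (Set.toFinite _)
        have := ih (by omega)
        omega
    have h1 := hcard _ le_rfl
    have h2 := Set.ncard_le_card (f (Nat.card D + 1))
    omega
  have hstep : ∀ j, f (n + j + 1) ⊆ f (n + j) := by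
    intro j
    induction j with
    | zero => exact hstat
    | succ j ih => exact stat _ ih
  have hconst : ∀ j, f (n + j) ⊆ f n := by
    intro j
    induction j with
    | zero => exact subset_rfl
    | succ j ih => exact (hstep j).trans ih
  rcases le_total b n with h | h
  · exact hm (h.trans hn)
  · obtain ⟨j, rfl⟩ := Nat.exists_eq_add_of_le h
    exact (hconst j).trans (hm hn)

end Sequences

section Attractor

variable {α : Type*}

/-- The attractor of `T` through `Sf`: positions from which the player owning `S0` can force a
visit to `T` while only visiting positions of `Sf` before. -/
inductive Attr (E : Set (WEdge α)) (S0 T Sf : Set α) : α → Prop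
  | target (x : α) : x ∈ T → Attr E S0 T Sf x
  | exists_edge (e : WEdge α) : e.1 ∈ Sf → e.1 ∈ S0 → e ∈ E → Attr E S0 T Sf e.2.2 →
      Attr E S0 T Sf e.1
  | forall_edge (x : α) : x ∈ Sf → x ∉ S0 → (∀ e ∈ E, e.1 = x → Attr E S0 T Sf e.2.2) →
      Attr E S0 T Sf x

theorem endSt_cons (s : α) (e : WEdge α) (ρ : List (WEdge α)) :
    EndSt s (e :: ρ) = EndSt e.2.2 ρ := by
  cases ρ with
  | nil => rfl
  | cons f ρ =>
    unfold EndSt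
    rw [List.getLast?_cons_cons]
    simp [List.getLast?_cons]

theorem endSt_concat (s : α) (e : WEdge α) (ρ : List (WEdge α)) :
    EndSt s (ρ ++ [e]) = e.2.2 := by
  simp [EndSt]

theorem isPrefixFrom_nil (E : Set (WEdge α)) (s : α) : IsPrefixFrom E s [] :=
  ⟨by simp, List.isChain_nil, by simp⟩

theorem isPrefixFrom_cons {E : Set (WEdge α)} {s : α} {e : WEdge α} {ρ : List (WEdge α)} :
    IsPrefixFrom E s (e :: ρ) ↔ e ∈ E ∧ e.1 = s ∧ IsPrefixFrom E e.2.2 ρ := by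
  change (_ ∧ List.IsChain _ _ ∧ _) ↔ _ ∧ _ ∧ _ ∧ List.IsChain _ _ ∧ _
  rw [List.isChain_cons]
  simp only [List.mem_cons, List.head?_cons, Option.some.injEq, Option.mem_def]
  constructor
  · rintro ⟨h1, ⟨h2, h3⟩, h4⟩
    exact ⟨h1 _ (Or.inl rfl), h4 _ rfl, fun e he => h1 _ (Or.inr he), h3,
      fun f hf => (h2 f hf).symm⟩
  · rintro ⟨h1, h2, h3, h4, h5⟩
    refine ⟨?_, ⟨fun f hf => (h5 f hf).symm, h4⟩, ?_⟩
    · rintro f (rfl | hf)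
      · exact h1
      · exact h3 f hf
    · rintro f rfl
      exact h2

theorem IsPrefixFrom.concat {E : Set (WEdge α)} {s : α} {e : WEdge α} {ρ : List (WEdge α)}
    (h : IsPrefixFrom E s ρ) (he : e ∈ E) (hs : e.1 = EndSt s ρ) :
    IsPrefixFrom E s (ρ ++ [e]) := by
  induction ρ generalizing s with
  | nil => exact isPrefixFrom_cons.2 ⟨he, hs, isPrefixFrom_nil _ _⟩
  | cons f ρ ih =>
    obtain ⟨h1, h2, h3⟩ := isPrefixFrom_cons.1 h
    exact isPrefixFrom_cons.2 ⟨h1, h2, ih h3 (by rw [hs, endSt_cons])⟩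

theorem pref_succ (π : ℕ → WEdge α) (n : ℕ) :
    Pref π (n + 1) = π 0 :: Pref (fun i => π (i + 1)) n := by
  simp [Pref, List.ofFn_succ]

theorem pref_succ_eq_concat (π : ℕ → WEdge α) (n : ℕ) :
    Pref π (n + 1) = Pref π n ++ [π n] := by
  unfold Pref
  rw [List.ofFn_succ_last]
  rfl

theorem endSt_pref (s : α) (π : ℕ → WEdge α) (n : ℕ) : EndSt s (Pref π n) = StAt s π n := by
  cases n with
  | zero => rfl
  | succ n => rw [pref_succ_eq_concat, endSt_concat]; rfl

theorem stAt_succ (s : α) (π : ℕ → WEdge α) (n : ℕ) :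
    StAt s π (n + 1) = StAt (π 0).2.2 (fun i => π (i + 1)) n := by
  cases n <;> rfl

/-- A strategy forcing a visit to `T` only exists from positions of the attractor of `T`. -/
theorem attr_of_strategy {E : Set (WEdge α)} {S0 T : Set α} {s : α}
    {σ : List (WEdge α) → WEdge α} (hσ : IsStrategy E S0 s σ)
    (hwin : ∀ π, IsOutcome E S0 s σ π → ∃ n, StAt s π n ∈ T) : Attr E S0 T Set.univ s := by
  classical
  by_contra hs
  have hopp : ∀ x, ∃ e : WEdge α, x ∉ S0 → ¬ Attr E S0 T Set.univ x →
      e ∈ E ∧ e.1 = x ∧ ¬ Attr E S0 T Set.univ e.2.2 := by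
    intro x
    by_cases hx : x ∉ S0 ∧ ¬ Attr E S0 T Set.univ x
    · by_contra! hc
      refine hx.2 (.forall_edge x trivial hx.1 fun e he hex => ?_)
      by_contra hne
      exact hne ((hc e).2.2 he hex)
    · by_cases hx0 : x ∈ S0
      · exact ⟨(x, 0, x), fun h => absurd hx0 h⟩
      · exact ⟨(x, 0, x), fun h h' => absurd ⟨h, h'⟩ hx⟩
  choose opp hopp using hopp
  let next : List (WEdge α) → WEdge α := fun ρ =>
    if EndSt s ρ ∈ S0 then σ ρ else opp (EndSt s ρ)
  let hist : ℕ → List (WEdge α) := fun n => Nat.rec [] (fun _ ρ => ρ ++ [next ρ]) n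
  have hist_succ : ∀ n, hist (n + 1) = hist n ++ [next (hist n)] := fun n => rfl
  let π : ℕ → WEdge α := fun n => next (hist n)
  have hpref : ∀ n, Pref π n = hist n := by
    intro n
    induction n with
    | zero => rfl
    | succ n ih => rw [pref_succ_eq_concat, ih, hist_succ]
  have hnext : ∀ ρ, IsPrefixFrom E s ρ → ¬ Attr E S0 T Set.univ (EndSt s ρ) →
      next ρ ∈ E ∧ (next ρ).1 = EndSt s ρ ∧ ¬ Attr E S0 T Set.univ (next ρ).2.2 := by
    intro ρ hρ hbad
    by_cases h0 : EndSt s ρ ∈ S0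
    · have hn : next ρ = σ ρ := if_pos h0
      obtain ⟨h1, h2⟩ := hσ ρ hρ h0
      rw [hn]
      refine ⟨h1, h2, fun ha => hbad ?_⟩
      rw [← h2]
      exact .exists_edge _ trivial (h2 ▸ h0) h1 ha
    · have hn : next ρ = opp (EndSt s ρ) := if_neg h0
      rw [hn]
      exact hopp _ h0 hbad
  have hinv : ∀ n, IsPrefixFrom E s (hist n) ∧ ¬ Attr E S0 T Set.univ (EndSt s (hist n)) := by
    intro n
    induction n with
    | zero => exact ⟨isPrefixFrom_nil _ _, hs⟩
    | succ n ih =>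
      obtain ⟨h1, h2, h3⟩ := hnext _ ih.1 ih.2
      rw [hist_succ, endSt_concat]
      exact ⟨ih.1.concat h1 h2, h3⟩
  have hedge := fun n => hnext _ (hinv n).1 (hinv n).2
  obtain ⟨n, hn⟩ := hwin π ⟨⟨fun n => (hedge n).1, (hedge 0).2.1, fun n => by
    change (next (hist n)).2.2 = (next (hist (n + 1))).1
    rw [(hedge (n + 1)).2.1, hist_succ, endSt_concat]⟩, fun n h => by
    rw [hpref] at h ⊢
    exact if_pos h⟩
  refine (hinv n).2 (.target _ ?_)
  rwa [← hpref, endSt_pref]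

/-- From every position of the attractor of `T` through `Sf` there is a strategy forcing a visit
to `T` through `Sf`. -/
theorem Attr.exists_strategy {E : Set (WEdge α)} {S0 T Sf : Set α}
    (htot : ∀ x, ∃ e ∈ E, e.1 = x) {s : α} (h : Attr E S0 T Sf s) :
    ∃ σ, IsStrategy E S0 s σ ∧ ∀ π, IsOutcome E S0 s σ π →
      ∃ n, StAt s π n ∈ T ∧ ∀ m < n, StAt s π m ∈ Sf := by
  classical
  have tail : ∀ {s : α} {σ : List (WEdge α) → WEdge α} {π : ℕ → WEdge α},
      IsOutcome E S0 s σ π →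
      IsOutcome E S0 (π 0).2.2 (fun ρ => σ (π 0 :: ρ)) (fun i => π (i + 1)) := by
    rintro s σ π ⟨⟨h1, h2, h3⟩, h4⟩
    refine ⟨⟨fun i => h1 _, (h3 0).symm, fun i => h3 _⟩, fun n hn => ?_⟩
    have := h4 (n + 1)
    rw [pref_succ, endSt_cons] at this
    exact this hn
  have reach : ∀ {s : α} {π : ℕ → WEdge α}, s ∈ Sf →
      (∃ n, StAt (π 0).2.2 (fun i => π (i + 1)) n ∈ T ∧
        ∀ m < n, StAt (π 0).2.2 (fun i => π (i + 1)) m ∈ Sf) →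
      ∃ n, StAt s π n ∈ T ∧ ∀ m < n, StAt s π m ∈ Sf := by
    rintro s π hs ⟨n, h1, h2⟩
    refine ⟨n + 1, by rwa [stAt_succ], fun m hm => ?_⟩
    cases m with
    | zero => exact hs
    | succ m => rw [stAt_succ]; exact h2 m (by omega)
  choose out hout1 hout2 using htot
  have hdef : ∀ x, IsStrategy E S0 x (fun ρ => out (EndSt x ρ)) :=
    fun x ρ _ _ => ⟨hout1 _, hout2 _⟩
  induction h with
  | target x hx => exact ⟨_, hdef x, fun π _ => ⟨0, hx, by simp⟩⟩
  | exists_edge e hsf h0 he _ ih =>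
    obtain ⟨σ, hσ, hw⟩ := ih
    let σ' : List (WEdge α) → WEdge α := fun ρ => match ρ with
      | [] => e
      | f :: ρ => if f = e then σ ρ else out (EndSt f.2.2 ρ)
    refine ⟨σ', fun ρ hρ hS => ?_, fun π hπ => ?_⟩
    · cases ρ with
      | nil => exact ⟨he, rfl⟩
      | cons f ρ =>
        obtain ⟨_, _, h3⟩ := isPrefixFrom_cons.1 hρ
        rw [endSt_cons] at hS ⊢
        by_cases hf : f = e
        · simp only [σ', if_pos hf]
          subst hf
          exact hσ ρ h3 hS
        · simp only [σ', if_neg hf]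
          exact hdef _ ρ h3 hS
    · have h1 : π 0 = e := hπ.2 0 h0
      refine reach hsf ?_
      have ht := tail hπ
      have h2 : (fun ρ => σ' (π 0 :: ρ)) = σ := by
        funext ρ
        simp only [σ', if_pos h1]
      rw [h2] at ht
      rw [h1] at ht ⊢
      exact hw _ ht
  | forall_edge x hsf h0 _ ih =>
    choose! σ hσ hw using ih
    let σ' : List (WEdge α) → WEdge α := fun ρ => match ρ with
      | [] => out x
      | f :: ρ => σ f ρ
    refine ⟨σ', fun ρ hρ hS => ?_, fun π hπ => ?_⟩
    · cases ρ with
      | nil => exact absurd hS h0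
      | cons f ρ =>
        obtain ⟨h1, h2, h3⟩ := isPrefixFrom_cons.1 hρ
        rw [endSt_cons] at hS ⊢
        exact hσ f h1 h2 ρ h3 hS
    · exact reach hsf (hw (π 0) (hπ.1.1 0) hπ.1.2.1 _ (tail hπ))

end Attractor

section Counter

variable {S : Type*}

/-- In the one-counter game of `G`, player `P₀` can force a visit to `R` from state `s` with
counter value `l`, such that all counter values met before are in `I`. -/
inductive Win (G : Game S) (I : Set ℤ) (R : Set (S × ℤ)) : S → ℤ → Prop
  | target (s : S) (l : ℤ) : (s, l) ∈ R → Win G I R s l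
  | exists_edge (s : S) (l w : ℤ) (s' : S) : l ∈ I → s ∈ G.S0 → (s, w, s') ∈ G.E →
      Win G I R s' (l + w) → Win G I R s l
  | forall_edge (s : S) (l : ℤ) : l ∈ I → s ∉ G.S0 →
      (∀ w s', (s, w, s') ∈ G.E → Win G I R s' (l + w)) → Win G I R s l

variable {G : Game S} {I I' : Set ℤ} {R R' : Set (S × ℤ)}

theorem Game.le_weight (G : Game S) {s s' : S} {w : ℤ} (h : (s, w, s') ∈ G.E) :
    -(G.W : ℤ) ≤ w ∧ w ≤ G.W := G.wbound _ h

theorem Win.mem_or_mem {s : S} {l : ℤ} (h : Win G I R s l) : l ∈ I ∨ (s, l) ∈ R := by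
  cases h with
  | target _ _ h => exact Or.inr h
  | exists_edge _ _ _ _ h => exact Or.inl h
  | forall_edge _ _ h => exact Or.inl h

theorem Win.shift {s : S} {l : ℤ} (h : Win G I R s l) (d : ℤ) (hI : ∀ l ∈ I, l + d ∈ I')
    (hR : ∀ s l, (s, l) ∈ R → (s, l + d) ∈ R') : Win G I' R' s (l + d) := by
  induction h with
  | target s l h => exact .target _ _ (hR _ _ h)
  | exists_edge s l w s' hl h0 he _ ih =>
    exact .exists_edge _ _ w s' (hI _ hl) h0 he (by rwa [add_right_comm])
  | forall_edge s l hl h0 _ ih =>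
    exact .forall_edge _ _ (hI _ hl) h0 fun w s' he => by
      rw [add_right_comm]
      exact ih w s' he

theorem Win.mono {s : S} {l : ℤ} (h : Win G I R s l) (hI : I ⊆ I') (hR : R ⊆ R') :
    Win G I' R' s l := by
  have := h.shift (I' := I') (R' := R') 0 (fun l hl => by simpa using hI hl)
    (fun s l hl => by simpa using hR hl)
  simpa using this

theorem Win.of_subset_win {s : S} {l : ℤ} (h : Win G I R s l)
    (hR : ∀ s l, (s, l) ∈ R → Win G I R' s l) : Win G I R' s l := by
  induction h with
  | target s l h => exact hR _ _ h
  | exists_edge s l w s' hl h0 he _ ih => exact .exists_edge _ _ w s' hl h0 he ih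
  | forall_edge s l hl h0 _ ih => exact .forall_edge _ _ hl h0 ih

/-- Only the targets within one step of nonnegative counter values matter. -/
theorem Win.restrict_target {s : S} {l : ℤ} (hI : ∀ l ∈ I, 0 ≤ l) (h : Win G I R s l)
    (hl : -(G.W : ℤ) ≤ l) : Win G I (R ∩ {p | -(G.W : ℤ) ≤ p.2}) s l := by
  induction h with
  | target s l h => exact .target _ _ ⟨h, hl⟩
  | exists_edge s l w s' hlI h0 he _ ih =>
    have := hI _ hlI
    have := G.le_weight he
    exact .exists_edge _ _ w s' hlI h0 he (ih (by omega))
  | forall_edge s l hlI h0 _ ih =>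
    refine .forall_edge _ _ hlI h0 fun w s' he => ih w s' he ?_
    have := hI _ hlI
    have := G.le_weight he
    omega

/-- Replacing the sets of allowed counter values at and above `L` does not matter if it does not
matter for the games played at and above `L`. -/
theorem Win.glue (L : ℤ) (hII : ∀ l < L, l ∈ I → l ∈ I')
    (hup : ∀ R' : Set (S × ℤ), (∀ p ∈ R', p.2 < L) → ∀ s l, L ≤ l → l < L + G.W →
      Win G (I ∩ Set.Ici L) R' s l → Win G (I' ∩ Set.Ici L) R' s l)
    (hR : ∀ p ∈ R, p.2 < L) {s : S} {l : ℤ} (h : Win G I R s l) (hl : l < L + G.W) :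
    Win G I' R s l := by
  let Q : Set (S × ℤ) := {p | p.2 < L ∧ Win G I' R p.1 p.2}
  have key : ∀ {s : S} {l : ℤ}, l < L + G.W → Win G (I ∩ Set.Ici L) Q s l → Win G I' R s l := by
    intro s l hl h
    rcases lt_or_ge l L with hlt | hge
    · rcases h.mem_or_mem with h | h
      · exact absurd h.2 (not_le.2 hlt)
      · exact h.2
    · exact ((hup Q (fun p hp => hp.1) s l hge hl h).mono Set.inter_subset_left
        subset_rfl).of_subset_win fun s l h => h.2
  refine key hl ?_
  clear hl
  induction h with
  | target s l h => exact .target _ _ ⟨hR _ h, .target _ _ h⟩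
  | exists_edge s l w s' hlI h0 he _ ih =>
    rcases lt_or_ge l L with hlt | hge
    · have := G.le_weight he
      exact .target _ _ ⟨hlt, .exists_edge _ _ w s' (hII _ hlt hlI) h0 he (key (by omega) ih)⟩
    · exact .exists_edge _ _ w s' ⟨hlI, hge⟩ h0 he ih
  | forall_edge s l hlI h0 _ ih =>
    rcases lt_or_ge l L with hlt | hge
    · refine .target _ _ ⟨hlt, .forall_edge _ _ (hII _ hlt hlI) h0 fun w s' he =>
        key ?_ (ih w s' he)⟩
      have := G.le_weight he
      omega
    · exact .forall_edge _ _ ⟨hlI, hge⟩ h0 ih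

theorem Game.finite_edges [Finite S] (G : Game S) : G.E.Finite := by
  refine ((Set.finite_univ (α := S)).prod
    ((Set.finite_Icc (-(G.W : ℤ)) G.W).prod (Set.finite_univ (α := S)))).subset ?_
  intro e he
  exact ⟨trivial, G.wbound e he, trivial⟩

theorem Win.exists_bound [Finite S] {s : S} {l : ℤ} (h : Win G (Set.Ici 0) R s l) :
    ∃ b : ℕ, Win G (Set.Ico 0 b) R s l := by
  have hmono : ∀ {s : S} {l : ℤ} {b b' : ℕ}, b ≤ b' → Win G (Set.Ico 0 b) R s l →
      Win G (Set.Ico 0 b') R s l := fun hb h =>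
    h.mono (Set.Ico_subset_Ico_right (by exact_mod_cast hb)) subset_rfl
  induction h with
  | target s l h => exact ⟨0, .target _ _ h⟩
  | exists_edge s l w s' hl h0 he _ ih =>
    obtain ⟨b, hb⟩ := ih
    refine ⟨max b (l.toNat + 1), .exists_edge _ _ w s' ⟨hl, ?_⟩ h0 he
      (hmono (le_max_left _ _) hb)⟩
    have : (0 : ℤ) ≤ l := hl
    omega
  | forall_edge s l hl h0 _ ih =>
    have ih' : ∀ e ∈ G.E, ∃ b : ℕ, e.1 = s → Win G (Set.Ico 0 b) R e.2.2 (l + e.2.1) := by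
      rintro ⟨s₁, w, s'⟩ he
      by_cases hs : s₁ = s
      · subst hs
        obtain ⟨b, hb⟩ := ih w s' he
        exact ⟨b, fun _ => hb⟩
      · exact ⟨0, fun h => absurd h hs⟩
    choose! f hf using ih'
    obtain ⟨B, hB⟩ := (G.finite_edges.image f).bddAbove
    refine ⟨max B (l.toNat + 1), .forall_edge _ _ ⟨hl, ?_⟩ h0 fun w s' he => ?_⟩
    · have : (0 : ℤ) ≤ l := hl
      omega
    · exact hmono ((hB ⟨_, he, rfl⟩).trans (le_max_left _ _)) (hf _ he rfl)

/-- The targets below `0` coded by a set of states with offsets. -/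
def negTargets (W : ℕ) (C : Set (S × Fin W)) : Set (S × ℤ) :=
  {p | ∃ i : Fin W, p.2 = -(1 + (i : ℤ)) ∧ (p.1, i) ∈ C}

/-- Which targets below `0` can be forced from which counter values in `[0, W)` by plays staying
in `[0, b)` before. -/
def forcing (G : Game S) (b : ℕ) : Set (Set (S × Fin G.W) × (S × Fin G.W)) :=
  {x | Win G (Set.Ico 0 b) (negTargets G.W x.1) x.2.1 (x.2.2 : ℕ)}

theorem negTargets_lt_zero {W : ℕ} {C : Set (S × Fin W)} : ∀ p ∈ negTargets W C, p.2 < 0 := by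
  rintro p ⟨i, hi, _⟩
  omega

theorem Win.of_forcing_subset {b b' : ℕ} (h : forcing G b ⊆ forcing G b')
    (hR : ∀ p ∈ R, p.2 < 0) {s : S} {l : ℤ} (hl0 : 0 ≤ l) (hlW : l < G.W)
    (hw : Win G (Set.Ico 0 b) R s l) : Win G (Set.Ico 0 b') R s l := by
  let C : Set (S × Fin G.W) := {p | (p.1, -(1 + ((p.2 : ℕ) : ℤ))) ∈ R}
  have hCR : negTargets G.W C ⊆ R := by
    rintro ⟨s, l⟩ ⟨i, hi, h⟩
    simp only at hi
    subst hi
    exact h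
  have hRC : R ∩ {p | -(G.W : ℤ) ≤ p.2} ⊆ negTargets G.W C := by
    rintro ⟨s, l⟩ ⟨h1, h2⟩
    have h3 := hR _ h1
    simp only [Set.mem_ofPred_eq] at h2 h3
    have h4 : l = -(1 + (((-l - 1).toNat : ℕ) : ℤ)) := by omega
    refine ⟨⟨(-l - 1).toNat, by omega⟩, h4, ?_⟩
    change (s, -(1 + (((-l - 1).toNat : ℕ) : ℤ))) ∈ R
    rwa [← h4]
  obtain ⟨i, rfl⟩ := Int.eq_ofNat_of_zero_le hl0
  have h1 : (C, (s, (⟨i, by omega⟩ : Fin G.W))) ∈ forcing G b :=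
    (hw.restrict_target (fun l hl => hl.1) (by omega)).mono subset_rfl hRC
  exact Win.mono (h h1) subset_rfl hCR

theorem forcing_mono (b : ℕ) : forcing G b ⊆ forcing G (b + 1) := fun _ hx =>
  Win.mono hx (Set.Ico_subset_Ico_right (by push_cast; omega)) subset_rfl

theorem forcing_stationary (b : ℕ) (h : forcing G (b + 1) ⊆ forcing G b) :
    forcing G (b + 2) ⊆ forcing G (b + 1) := by
  rintro ⟨C, s, i⟩ hx
  refine Win.glue (I := Set.Ico 0 ((b + 2 : ℕ) : ℤ)) 1 ?_ ?_ ?_ hx ?_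
  · rintro l hl ⟨h0, _⟩
    exact ⟨h0, by push_cast; omega⟩
  · intro R' hR' s l hl1 hlW hw
    have hdown : Win G (Set.Ico 0 ((b + 1 : ℕ) : ℤ)) {p | (p.1, p.2 + 1) ∈ R'} s (l + -1) := by
      refine hw.shift (-1) ?_ ?_
      · rintro l ⟨⟨h0, h1⟩, h2⟩
        simp only [Set.mem_Ici] at h2
        push_cast at h1 ⊢
        exact ⟨by omega, by omega⟩
      · intro s l h
        simpa using h
    have hst := Win.of_forcing_subset h (fun p hp => by have := hR' _ hp; simp only at this; omega)
      (by omega) (by omega) hdown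
    have hres : Win G (Set.Ico 0 ((b + 1 : ℕ) : ℤ) ∩ Set.Ici 1) R' s (l + -1 + 1) := by
      refine hst.shift 1 ?_ fun s l h => h
      rintro l ⟨h0, h1⟩
      refine ⟨⟨by omega, by push_cast; omega⟩, ?_⟩
      simp only [Set.mem_Ici]
      omega
    simpa using hres
  · intro p hp
    have := negTargets_lt_zero p hp
    omega
  · have := i.2
    simp only
    omega

theorem card_forcing_index [Fintype S] (W : ℕ) :
    Nat.card (Set (S × Fin W) × (S × Fin W)) =
      2 ^ (Fintype.card S * W) * (Fintype.card S * W) := by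
  classical
  simp [Nat.card_eq_fintype_card, Fintype.card_prod]

/-- If the targets are below `L`, counter values from `L + |S| W 2 ^ (|S| W)` on are not needed. -/
theorem Win.bounded [Fintype S] {L : ℕ} (hR : ∀ p ∈ R, p.2 < L) {s : S} {l : ℤ} (hl : l < L)
    (h : Win G (Set.Ici 0) R s l) :
    Win G (Set.Ico 0 ((L + 2 ^ (Fintype.card S * G.W) * (Fintype.card S * G.W) : ℕ) : ℤ)) R s l := by
  rw [← card_forcing_index]
  set B := Nat.card (Set (S × Fin G.W) × (S × Fin G.W))
  refine Win.glue (I := Set.Ici 0) L ?_ ?_ hR h (by omega)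
  · rintro l hl h0
    exact ⟨h0, by push_cast; omega⟩
  · intro R' hR' s l hlL hlW hw
    have hdown : Win G (Set.Ici 0) {p | (p.1, p.2 + L) ∈ R'} s (l + -(L : ℤ)) := by
      refine hw.shift (-(L : ℤ)) ?_ ?_
      · rintro l ⟨_, h2⟩
        simp only [Set.mem_Ici] at h2 ⊢
        omega
      · intro s l h
        simpa using h
    obtain ⟨b, hb⟩ := hdown.exists_bound
    have hst := Win.of_forcing_subset
      (subset_of_stationary (forcing G) forcing_mono forcing_stationary b)
      (fun p hp => by have := hR' _ hp; simp only at this; omega) (by omega) (by omega) hb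
    have hres : Win G (Set.Ico 0 ((L + B : ℕ) : ℤ) ∩ Set.Ici (L : ℤ)) R' s
        (l + -(L : ℤ) + L) := by
      refine hst.shift L ?_ fun s l h => h
      rintro l ⟨h0, h1⟩
      refine ⟨⟨by omega, by push_cast; omega⟩, ?_⟩
      simp only [Set.mem_Ici]
      omega
    simpa using hres

end Counter

section Expanded

variable {S : Type*} {G : Game S} {t : ℚ}

/-- The configurations of `Γ'` as pairs with integer counter values. -/
def intTargets (Γ' : Set (Conf S)) : Set (S × ℤ) :=
  {p | ∃ c : ℕ, p.2 = c ∧ (some (p.1, c) : Conf S) ∈ Γ'}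

theorem some_mem_expS0 {s : S} {c : ℕ} : (some (s, c) : Conf S) ∈ ExpS0 G ↔ s ∈ G.S0 := by
  simp [ExpS0]

theorem mem_expE_of_edge {s s' : S} {w : ℤ} {c c' : ℕ} (he : (s, w, s') ∈ G.E)
    (h : (c : ℤ) + w = c') : ((some (s, c), (c' : ℤ), some (s', c')) : WEdge (Conf S)) ∈ ExpE G t :=
  Or.inl ⟨s, c, w, s', c', he, h, rfl⟩

theorem exists_edge_of_mem_expE {s s' : S} {c c' : ℕ} {v : ℤ}
    (h : ((some (s, c), v, some (s', c')) : WEdge (Conf S)) ∈ ExpE G t) :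
    ∃ w : ℤ, (s, w, s') ∈ G.E ∧ (c : ℤ) + w = c' := by
  rcases h with ⟨s₁, c₁, w, s₂, c₂, he, hc, heq⟩ | ⟨s₁, c₁, w, s₂, he, hc, heq⟩ | heq
  · simp only [Prod.mk.injEq, Option.some.injEq] at heq
    obtain ⟨⟨rfl, rfl⟩, -, rfl, rfl⟩ := heq
    exact ⟨w, he, hc⟩
  · simp at heq
  · simp at heq

theorem exists_expE (G : Game S) (t : ℚ) (x : Conf S) : ∃ e ∈ ExpE G t, e.1 = x := by
  rcases x with _ | ⟨s, c⟩
  · exact ⟨_, Or.inr (Or.inr rfl), rfl⟩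
  · obtain ⟨w, s', he⟩ := G.total s
    rcases lt_or_ge ((c : ℤ) + w) 0 with h | h
    · exact ⟨_, Or.inr (Or.inl ⟨s, c, w, s', he, h, rfl⟩), rfl⟩
    · obtain ⟨c', hc'⟩ := Int.eq_ofNat_of_zero_le h
      exact ⟨_, mem_expE_of_edge he hc', rfl⟩

theorem Attr.exists_win {Γ' : Set (Conf S)} (hΓ : none ∉ Γ') {x : Conf S}
    (h : Attr (ExpE G t) (ExpS0 G) Γ' Set.univ x) :
    ∃ s c, x = some (s, c) ∧ Win G (Set.Ici 0) (intTargets Γ') s (c : ℕ) := by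
  induction h with
  | target x hx =>
    rcases x with _ | ⟨s, c⟩
    · exact absurd hx hΓ
    · exact ⟨s, c, rfl, .target _ _ ⟨c, rfl, hx⟩⟩
  | exists_edge e _ h0 he _ ih =>
    obtain ⟨x, v, y⟩ := e
    obtain ⟨s, c, hs, rfl⟩ := h0
    simp only at ih
    obtain ⟨s', c', rfl, hw⟩ := ih
    obtain ⟨w, hE, hc⟩ := exists_edge_of_mem_expE he
    exact ⟨s, c, rfl, .exists_edge _ _ w s' (Int.natCast_nonneg c) hs hE (hc ▸ hw)⟩
  | forall_edge x _ h0 _ ih =>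
    rcases x with _ | ⟨s, c⟩
    · obtain ⟨_, _, h, _⟩ := ih _ (Or.inr (Or.inr rfl)) rfl
      simp at h
    · refine ⟨s, c, rfl, .forall_edge _ _ (Int.natCast_nonneg c)
        (fun h => h0 (some_mem_expS0.2 h)) fun w s' he => ?_⟩
      rcases lt_or_ge ((c : ℤ) + w) 0 with h | h
      · obtain ⟨_, _, h, _⟩ := ih _ (Or.inr (Or.inl ⟨s, c, w, s', he, h, rfl⟩)) rfl
        simp at h
      · obtain ⟨c', hc'⟩ := Int.eq_ofNat_of_zero_le h
        obtain ⟨s₂, c₂, h₂, hw⟩ := ih _ (mem_expE_of_edge he hc') rfl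
        simp only [Option.some.injEq, Prod.mk.injEq] at h₂
        obtain ⟨rfl, rfl⟩ := h₂
        rw [hc']
        exact hw

theorem Win.attr {Γ' : Set (Conf S)} {I : Set ℤ} (hI : ∀ l ∈ I, 0 ≤ l) {s : S} {l : ℤ}
    (h : Win G I (intTargets Γ') s l) :
    ∀ c : ℕ, l = c → Attr (ExpE G t) (ExpS0 G) Γ'
      {γ | ∀ (s : S) (c : ℕ), γ = some (s, c) → (c : ℤ) ∈ I} (some (s, c)) := by
  have hnn : ∀ {s : S} {l : ℤ}, Win G I (intTargets Γ') s l → 0 ≤ l := by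
    intro s l h
    rcases h.mem_or_mem with h | ⟨c, h, _⟩
    · exact hI _ h
    · simp only at h
      omega
  have hsafe : ∀ (s : S) (c : ℕ), (c : ℤ) ∈ I →
      (some (s, c) : Conf S) ∈ {γ | ∀ (s : S) (c : ℕ), γ = some (s, c) → (c : ℤ) ∈ I} := by
    rintro s c hc s' c' h
    simp only [Option.some.injEq, Prod.mk.injEq] at h
    rwa [← h.2]
  induction h with
  | target s l h =>
    rintro c rfl
    obtain ⟨c', h1, h2⟩ := h
    simp only [Nat.cast_inj] at h1
    subst h1
    exact .target _ h2
  | exists_edge s l w s' hl h0 he hw ih =>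
    rintro c rfl
    obtain ⟨c', hc'⟩ := Int.eq_ofNat_of_zero_le (hnn hw)
    exact .exists_edge (some (s, c), (c' : ℤ), some (s', c')) (hsafe s c hl)
      (some_mem_expS0.2 h0) (mem_expE_of_edge he hc') (ih c' hc')
  | forall_edge s l hl h0 hw ih =>
    rintro c rfl
    refine .forall_edge _ (hsafe s c hl) (fun h => h0 (some_mem_expS0.1 h)) ?_
    rintro e (⟨s₁, c₁, w, s₂, c₂, he, hc, rfl⟩ | ⟨s₁, c₁, w, s₂, he, hc, rfl⟩ | rfl) hx
    · simp only [Option.some.injEq, Prod.mk.injEq] at hx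
      obtain ⟨rfl, rfl⟩ := hx
      exact ih w s₂ he c₂ hc
    · simp only [Option.some.injEq, Prod.mk.injEq] at hx
      obtain ⟨rfl, rfl⟩ := hx
      exact absurd (hnn (hw w s₂ he)) (not_le.2 hc)
    · simp at hx

end Expanded

theorem Game.card_le_ncard_edges {S : Type*} [Fintype S] (G : Game S) :
    Fintype.card S ≤ G.E.ncard := by
  choose w s' h using G.total
  rw [← Nat.card_eq_fintype_card, ← Set.ncard_univ]
  exact Set.ncard_le_ncard_of_injOn (fun s => (s, w s, s' s)) (fun s _ => h s)
    (fun a _ b _ hab => congrArg Prod.fst hab) G.finite_edges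

theorem add_two_pow_mul_le {a N n : ℕ} (h : a + 2 * N + 1 ≤ n) : a + 2 ^ N * N ≤ 2 ^ n := by
  have h1 : a ≤ 2 ^ (a + 2 * N) :=
    Nat.lt_two_pow_self.le.trans (Nat.pow_le_pow_right (by norm_num) (by omega))
  have h2 : 2 ^ N * N ≤ 2 ^ (a + 2 * N) := by
    calc 2 ^ N * N ≤ 2 ^ N * 2 ^ N := Nat.mul_le_mul_left _ Nat.lt_two_pow_self.le
      _ = 2 ^ (2 * N) := by rw [← pow_add, two_mul]
      _ ≤ 2 ^ (a + 2 * N) := Nat.pow_le_pow_right (by norm_num) (by omega)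
  calc a + 2 ^ N * N ≤ 2 ^ (a + 2 * N + 1) := by rw [pow_succ]; omega
    _ ≤ 2 ^ n := Nat.pow_le_pow_right (by norm_num) h

/-- There is an absolute constant `k` such that: for every finite weighted
game `G` with maximal absolute weight `W`, threshold `t ≥ 0`, and `M ∈ ℕ`, setting
`M' = 2^{k·(M + |S| + |E|·W + |S|·(⌈t⌉+1))}`, for every configuration `γ = (s,c)` of the
expanded game `G'` with `c ≤ M` and every `Γ' ⊆ Γ^{≤t}`: if `P₀` has a strategy ensuring
from `γ` that `Γ'` is eventually visited, then `P₀` also has a strategy ensuring from `γ`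
that `Γ'` is eventually visited while every configuration `(s'',c'')` visited before that
satisfies `c'' ≤ M'`. -/
theorem statement1 :
    ∃ k : ℕ, ∀ (S : Type) [Fintype S], ∀ (G : Game S) (t : ℚ), 0 ≤ t →
      ∀ (M : ℕ) (s : S) (c : ℕ), c ≤ M →
      ∀ Γ' : Set (Conf S),
        (∀ γ' ∈ Γ', ∃ (s' : S) (c' : ℕ), (c' : ℚ) ≤ t ∧ γ' = some (s', c')) →
        (∃ σ, IsStrategy (ExpE G t) (ExpS0 G) (some (s, c)) σ ∧
          ∀ π, IsOutcome (ExpE G t) (ExpS0 G) (some (s, c)) σ π →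
            ∃ n, StAt (some (s, c)) π n ∈ Γ') →
        (∃ σ, IsStrategy (ExpE G t) (ExpS0 G) (some (s, c)) σ ∧
          ∀ π, IsOutcome (ExpE G t) (ExpS0 G) (some (s, c)) σ π →
            ∃ n, StAt (some (s, c)) π n ∈ Γ' ∧
              ∀ m < n, ∀ (s'' : S) (c'' : ℕ),
                StAt (some (s, c)) π m = some (s'', c'') →
                  c'' ≤ 2 ^ (k * (M + Fintype.card S + G.E.ncard * G.W +
                    Fintype.card S * (⌈t⌉.toNat + 1)))) := by
  refine ⟨2, fun S _ G t _ M s c hcM Γ' hΓ ⟨σ, hσ, hwin⟩ => ?_⟩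
  have hnone : (none : Conf S) ∉ Γ' := fun h => by
    obtain ⟨_, _, _, h⟩ := hΓ _ h
    simp at h
  obtain ⟨s₁, c₁, heq, hw⟩ := (attr_of_strategy hσ hwin).exists_win hnone
  simp only [Option.some.injEq, Prod.mk.injEq] at heq
  obtain ⟨rfl, rfl⟩ := heq
  have hR : ∀ p ∈ intTargets Γ', p.2 < ((M + ⌈t⌉.toNat + 1 : ℕ) : ℤ) := by
    rintro ⟨s', l⟩ ⟨c', hl, hmem⟩
    obtain ⟨s₂, c₂, hct, h⟩ := hΓ _ hmem
    simp only [Option.some.injEq, Prod.mk.injEq] at h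
    obtain ⟨-, rfl⟩ := h
    have h1 : (c' : ℤ) ≤ ⌈t⌉ := by
      have : ((c' : ℤ) : ℚ) ≤ ⌈t⌉ := le_trans (by exact_mod_cast hct) (Int.le_ceil t)
      exact_mod_cast this
    simp only at hl ⊢
    omega
  have hb := hw.bounded hR (by push_cast; omega)
  obtain ⟨σ', hσ', hwin'⟩ := (hb.attr (t := t) (fun l hl => hl.1) c rfl).exists_strategy
    (exists_expE G t)
  refine ⟨σ', hσ', fun π hπ => ?_⟩
  obtain ⟨n, hn, hsafe⟩ := hwin' π hπ
  refine ⟨n, hn, fun m hm s'' c'' hst => ?_⟩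
  have hlt := (hsafe m hm s'' c'' hst).2
  have hlt : c'' < M + ⌈t⌉.toNat + 1 + 2 ^ (Fintype.card S * G.W) * (Fintype.card S * G.W) := by
    exact_mod_cast hlt
  have hle : c'' ≤ M + ⌈t⌉.toNat + 2 ^ (Fintype.card S * G.W) * (Fintype.card S * G.W) := by
    omega
  refine hle.trans (add_two_pow_mul_le ?_)
  have hS : 1 ≤ Fintype.card S := Fintype.card_pos_iff.2 ⟨s⟩
  have h1 : Fintype.card S * G.W ≤ G.E.ncard * G.W :=
    Nat.mul_le_mul_right _ G.card_le_ncard_edges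
  have h2 : ⌈t⌉.toNat + 1 ≤ Fintype.card S * (⌈t⌉.toNat + 1) := Nat.le_mul_of_pos_left _ hS
  omega

end AvgEnergy
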